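/- Suppose the separation condition holds at index i, the beta constraint holds, and N > max{144 β M_W², 1/((4 M_W² + 2d(λ_max + λ_min)) β)}, and let X_i* be the unique fixed point of Φ in B_i. Then for every query ξ ∈ B_i and every ε with 0 < ε < r = 1/√(βN), one has d_BW(Φⁿ(ξ), X_i*) < ε for every integer n ≥ ⌈log((ε/2)√(βN)) / log(144 β M_W² / N)⌉, where Φⁿ denotes the n-fold iterate of Φ. -/

import Mathlib

open Real Finset MeasureTheory

/-- A Gaussian parameter: a pair `(m, ω)` of mean vector and vector of covariance
eigenvalues (in a fixed common eigenbasis). -/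
abbrev GaussParam (d : ℕ) := (Fin d → ℝ) × (Fin d → ℝ)

/-- Bures–Wasserstein distance between two Gaussian parameters. -/
noncomputable def dBW {d : ℕ} (x y : GaussParam d) : ℝ :=
  Real.sqrt ((∑ ℓ, (x.1 ℓ - y.1 ℓ) ^ 2) +
    ∑ ℓ, (Real.sqrt (x.2 ℓ) - Real.sqrt (y.2 ℓ)) ^ 2)

/-- Gibbs weights of the Wasserstein dense associative memory. -/
noncomputable def gibbsW {d N : ℕ} (β : ℝ) (X : Fin N → GaussParam d)
    (ξ : GaussParam d) (k : Fin N) : ℝ :=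
  Real.exp (-β * (dBW (X k) ξ) ^ 2) / ∑ j, Real.exp (-β * (dBW (X j) ξ) ^ 2)

/-- The retrieval operator `Φ`. -/
noncomputable def PhiOp {d N : ℕ} (β : ℝ) (X : Fin N → GaussParam d)
    (ξ : GaussParam d) : GaussParam d :=
  (fun ℓ => ∑ k, gibbsW β X ξ k * (X k).1 ℓ,
   fun ℓ => (∑ k, gibbsW β X ξ k * Real.sqrt ((X k).2 ℓ)) ^ 2)

/-- `I(X_i, X_j) = − log ⟨X_i , X_j⟩_{L²}` for Gaussian parameters with a common
eigenbasis. -/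
noncomputable def Ifun {d : ℕ} (x y : GaussParam d) : ℝ :=
  (d / 2 : ℝ) * Real.log (2 * Real.pi)
    + (1 / 2) * ∑ ℓ, Real.log (x.2 ℓ + y.2 ℓ)
    + (1 / 2) * ∑ ℓ, (x.1 ℓ - y.1 ℓ) ^ 2 / (x.2 ℓ + y.2 ℓ)

section AbstractPart

variable {E : Type*} [NormedAddCommGroup E] [InnerProductSpace ℝ E]

noncomputable def absW {N : ℕ} (β : ℝ) (Z : Fin N → E) (z : E) (k : Fin N) : ℝ :=
  Real.exp (-β * ‖Z k - z‖ ^ 2) / ∑ j, Real.exp (-β * ‖Z j - z‖ ^ 2)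

noncomputable def absT {N : ℕ} (β : ℝ) (Z : Fin N → E) (z : E) : E :=
  ∑ k, absW β Z z k • Z k

lemma absDen_pos {N : ℕ} (β : ℝ) (Z : Fin N → E) (z : E) (k : Fin N) :
    0 < ∑ j, Real.exp (-β * ‖Z j - z‖ ^ 2) :=
  Finset.sum_pos (fun _ _ => Real.exp_pos _) ⟨k, Finset.mem_univ _⟩

lemma absW_nonneg {N : ℕ} (β : ℝ) (Z : Fin N → E) (z : E) (k : Fin N) :
    0 ≤ absW β Z z k :=
  div_nonneg (Real.exp_pos _).le (absDen_pos β Z z k).le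

lemma absW_sum {N : ℕ} (hN : 0 < N) (β : ℝ) (Z : Fin N → E) (z : E) :
    ∑ k, absW β Z z k = 1 := by
  unfold absW
  rw [← Finset.sum_div]
  exact div_self (absDen_pos β Z z ⟨0, hN⟩).ne'

lemma absW_small {N : ℕ} (β L r : ℝ) (hβ : 0 < β) (Z : Fin N → E) (i j : Fin N) (hij : j ≠ i)
    (hL : 2 ≤ L) (hLN : (N : ℝ) ^ 2 ≤ Real.exp L) (hr0 : 0 ≤ r) (hr : β * r ^ 2 * N = 1)
    (hsep : 4 * L ≤ β * ‖Z j - Z i‖ ^ 2) (z : E) (hz : ‖Z i - z‖ ≤ r) :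
    absW β Z z j ≤ 1 / (N : ℝ) ^ 4 := by
  have hN2 : (2 : ℝ) ≤ N := by
    have : 2 ≤ N := by
      have h1 := i.2
      have h2 := j.2
      have : (j : ℕ) ≠ i := fun h => hij (Fin.ext h)
      omega
    exact_mod_cast this
  have hD0 : 0 ≤ ‖Z j - Z i‖ := norm_nonneg _
  have hrD : 4 * r ≤ ‖Z j - Z i‖ := by
    apply le_of_sq_le_sq _ hD0
    have h1 : β * r ^ 2 ≤ 1 / 2 := by
      have : 0 ≤ β * r ^ 2 := by positivity
      nlinarith
    have h2 : β * (4 * r) ^ 2 ≤ β * ‖Z j - Z i‖ ^ 2 := by nlinarith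
    exact le_of_mul_le_mul_left h2 hβ
  have htri : ‖Z j - Z i‖ - ‖Z i - z‖ ≤ ‖Z j - z‖ := by
    have := norm_sub_le (Z j - z) (Z i - z)
    rw [sub_sub_sub_cancel_right] at this
    linarith
  have hkey : 2 * L ≤ β * (‖Z j - z‖ ^ 2 - ‖Z i - z‖ ^ 2) := by
    have h3 : ‖Z j - Z i‖ ^ 2 / 2 ≤ ‖Z j - z‖ ^ 2 - ‖Z i - z‖ ^ 2 := by
      have h0 : 0 ≤ ‖Z i - z‖ := norm_nonneg _
      have : (‖Z j - Z i‖ - ‖Z i - z‖) ^ 2 ≤ ‖Z j - z‖ ^ 2 := by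
        apply pow_le_pow_left₀ _ htri
        linarith
      nlinarith
    nlinarith [mul_le_mul_of_nonneg_left h3 hβ.le]
  have hi : Real.exp (-β * ‖Z i - z‖ ^ 2) ≤ ∑ k, Real.exp (-β * ‖Z k - z‖ ^ 2) :=
    Finset.single_le_sum (f := fun k => Real.exp (-β * ‖Z k - z‖ ^ 2))
      (fun _ _ => (Real.exp_pos _).le) (Finset.mem_univ i)
  have hNp : (0 : ℝ) < (N : ℝ) ^ 4 := by positivity
  unfold absW
  rw [div_le_div_iff₀ (absDen_pos β Z z i) hNp, one_mul]
  refine le_trans ?_ hi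
  have h4 : (N : ℝ) ^ 4 ≤ Real.exp (2 * L) := by
    have : Real.exp (2 * L) = Real.exp L ^ 2 := by
      rw [← Real.exp_nat_mul]; norm_num
    rw [this]
    calc (N : ℝ) ^ 4 = ((N : ℝ) ^ 2) ^ 2 := by ring
      _ ≤ _ := pow_le_pow_left₀ (by positivity) hLN 2
  calc _ ≤ Real.exp (-β * ‖Z j - z‖ ^ 2) * Real.exp (2 * L) :=
        mul_le_mul_of_nonneg_left h4 (Real.exp_pos _).le
    _ = Real.exp (-β * ‖Z j - z‖ ^ 2 + 2 * L) := (Real.exp_add _ _).symm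
    _ ≤ _ := by
        apply Real.exp_le_exp.mpr
        nlinarith

lemma absT_sub {N : ℕ} (hN : 0 < N) (β : ℝ) (Z : Fin N → E) (i : Fin N) (z : E) :
    absT β Z z - Z i = ∑ k, absW β Z z k • (Z k - Z i) := by
  unfold absT
  simp only [smul_sub, Finset.sum_sub_distrib]
  rw [← Finset.sum_smul, absW_sum hN, one_smul]

/-- sum bound -/
lemma absSum_bound {N : ℕ} (Z : Fin N → E) (i : Fin N) (M c : ℝ) (hc : 0 ≤ c)
    (hM0 : 0 ≤ M) (hM : ∀ k, ‖Z k‖ ≤ M) (a : Fin N → ℝ) (ha : ∀ j, j ≠ i → |a j| ≤ c) :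
    ‖∑ k, a k • (Z k - Z i)‖ ≤ N * (c * (2 * M)) := by
  have h : ∀ k ∈ (Finset.univ : Finset (Fin N)), ‖a k • (Z k - Z i)‖ ≤ c * (2 * M) := by
    intro k _
    by_cases hk : k = i
    · subst hk; simp; positivity
    · rw [norm_smul, Real.norm_eq_abs]
      have : ‖Z k - Z i‖ ≤ 2 * M := by
        have := norm_sub_le (Z k) (Z i)
        linarith [hM k, hM i]
      exact mul_le_mul (ha k hk) this (norm_nonneg _) hc
  refine (norm_sum_le_of_le _ h).trans ?_
  simp

lemma absW_ratio {N : ℕ} (β M : ℝ) (hβ : 0 < β) (Z : Fin N → E)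
    (hM : ∀ k, ‖Z k‖ ≤ M) (z z' : E) (j : Fin N) :
    absW β Z z' j ≤ Real.exp (4 * β * M * ‖z - z'‖) * absW β Z z j := by
  have hin : ∀ k, |inner ℝ (Z k) (z' - z)| ≤ M * ‖z - z'‖ := by
    intro k
    refine (abs_real_inner_le_norm _ _).trans ?_
    rw [norm_sub_rev z' z]
    exact mul_le_mul_of_nonneg_right (hM k) (norm_nonneg _)
  have hid : ∀ k, -β * ‖Z k - z'‖ ^ 2 =
      -β * ‖Z k - z‖ ^ 2 + 2 * β * inner ℝ (Z k) (z' - z) - β * (‖z'‖ ^ 2 - ‖z‖ ^ 2) := by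
    intro k
    rw [norm_sub_sq_real, norm_sub_sq_real, inner_sub_right]
    ring
  set s := 2 * β * (M * ‖z - z'‖) with hs
  set c := β * (‖z'‖ ^ 2 - ‖z‖ ^ 2) with hcdef
  have hup : ∀ k, Real.exp (-β * ‖Z k - z'‖ ^ 2) ≤
      Real.exp (s - c) * Real.exp (-β * ‖Z k - z‖ ^ 2) := by
    intro k
    rw [← Real.exp_add, Real.exp_le_exp, hid]
    nlinarith [(abs_le.mp (hin k)).2]
  have hlo : ∀ k, Real.exp (-s - c) * Real.exp (-β * ‖Z k - z‖ ^ 2) ≤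
      Real.exp (-β * ‖Z k - z'‖ ^ 2) := by
    intro k
    rw [← Real.exp_add, Real.exp_le_exp, hid]
    nlinarith [(abs_le.mp (hin k)).1]
  have hden : Real.exp (-s - c) * ∑ k, Real.exp (-β * ‖Z k - z‖ ^ 2) ≤
      ∑ k, Real.exp (-β * ‖Z k - z'‖ ^ 2) := by
    rw [Finset.mul_sum]
    exact Finset.sum_le_sum fun k _ => hlo k
  have hp := absDen_pos β Z z j
  unfold absW
  calc _ ≤ (Real.exp (s - c) * Real.exp (-β * ‖Z j - z‖ ^ 2)) /
        (Real.exp (-s - c) * ∑ k, Real.exp (-β * ‖Z k - z‖ ^ 2)) :=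
        div_le_div₀ (by positivity) (hup j) (by positivity) hden
    _ = (Real.exp (s - c) / Real.exp (-s - c)) * (Real.exp (-β * ‖Z j - z‖ ^ 2) /
        ∑ k, Real.exp (-β * ‖Z k - z‖ ^ 2)) := mul_div_mul_comm _ _ _ _
    _ = _ := by
        rw [← Real.exp_sub]
        congr 2
        rw [hs]; ring

lemma absW_diff {N : ℕ} (β M c : ℝ) (hβ : 0 < β) (Z : Fin N → E)
    (hM : ∀ k, ‖Z k‖ ≤ M) (z z' : E) (j : Fin N)
    (h : absW β Z z j ≤ c) (h' : absW β Z z' j ≤ c) :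
    |absW β Z z j - absW β Z z' j| ≤ 4 * β * M * ‖z - z'‖ * c := by
  have hM0 : 0 ≤ M := (norm_nonneg _).trans (hM j)
  have aux : ∀ u v : E, absW β Z u j ≤ c →
      absW β Z u j - absW β Z v j ≤ 4 * β * M * ‖u - v‖ * c := by
    intro u v hu
    have h1 := absW_ratio β M hβ Z hM v u j
    rw [norm_sub_rev] at h1
    set t := 4 * β * M * ‖u - v‖
    have ht : 0 ≤ t := by positivity
    have h0 := absW_nonneg β Z u j
    have h2 : Real.exp (-t) * absW β Z u j ≤ absW β Z v j := by
      calc _ ≤ Real.exp (-t) * (Real.exp t * absW β Z v j) :=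
            mul_le_mul_of_nonneg_left h1 (Real.exp_pos _).le
        _ = _ := by rw [← mul_assoc, ← Real.exp_add]; simp
    have h3 := Real.add_one_le_exp (-t)
    nlinarith
  rw [abs_le]
  constructor
  · have := aux z' z h'
    rw [norm_sub_rev] at this
    linarith
  · exact aux z z' h

lemma absT_diff {N : ℕ} (hN : 0 < N) (β M : ℝ) (hβ : 0 < β) (Z : Fin N → E) (i : Fin N)
    (hM : ∀ k, ‖Z k‖ ≤ M) (z z' : E)
    (h : ∀ j, j ≠ i → absW β Z z j ≤ 1 / (N : ℝ) ^ 4)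
    (h' : ∀ j, j ≠ i → absW β Z z' j ≤ 1 / (N : ℝ) ^ 4) :
    ‖absT β Z z - absT β Z z'‖ ≤ 8 * β * M ^ 2 / N * ‖z - z'‖ := by
  have hM0 : 0 ≤ M := (norm_nonneg _).trans (hM i)
  have hN1 : (1 : ℝ) ≤ N := by exact_mod_cast hN
  have e : absT β Z z - absT β Z z' =
      ∑ k, (absW β Z z k - absW β Z z' k) • (Z k - Z i) := by
    simp only [sub_smul _ _ (_ - _), Finset.sum_sub_distrib]
    rw [← absT_sub hN, ← absT_sub hN, sub_sub_sub_cancel_right]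
  rw [e]
  refine (absSum_bound Z i M (4 * β * M * ‖z - z'‖ * (1 / (N : ℝ) ^ 4)) (by positivity) hM0 hM _
    (fun j hj => absW_diff β M _ hβ Z hM z z' j (h j hj) (h' j hj))).trans ?_
  have h1 : (N : ℝ) * (1 / (N : ℝ) ^ 4) ≤ 1 / N := by
    rw [mul_one_div, div_le_div_iff₀ (by positivity) (by positivity), one_mul, ← sq]
    exact pow_le_pow_right₀ hN1 (by norm_num)
  calc _ = (8 * β * M ^ 2 * ‖z - z'‖) * ((N : ℝ) * (1 / (N : ℝ) ^ 4)) := by ring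
    _ ≤ (8 * β * M ^ 2 * ‖z - z'‖) * (1 / N) := mul_le_mul_of_nonneg_left h1 (by positivity)
    _ = _ := by ring

lemma absT_ball {N : ℕ} (hN : 0 < N) (β M r : ℝ) (hβ : 0 < β) (Z : Fin N → E) (i : Fin N)
    (hM : ∀ k, ‖Z k‖ ≤ M) (hr0 : 0 ≤ r) (hr : β * r ^ 2 * N = 1) (hbig : 144 * β * M ^ 2 < N)
    (z : E) (h : ∀ j, j ≠ i → absW β Z z j ≤ 1 / (N : ℝ) ^ 4) :
    ‖Z i - absT β Z z‖ ≤ r := by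
  have hM0 : 0 ≤ M := (norm_nonneg _).trans (hM i)
  have hN1 : (1 : ℝ) ≤ N := by exact_mod_cast hN
  rw [norm_sub_rev, absT_sub hN]
  refine (absSum_bound Z i M (1 / (N : ℝ) ^ 4) (by positivity) hM0 hM _
    (fun j hj => ?_)).trans ?_
  · rw [abs_of_nonneg (absW_nonneg _ _ _ _)]; exact h j hj
  have h1 : 12 * M ≤ N * r := by
    apply le_of_sq_le_sq _ (by positivity)
    have : β * (12 * M) ^ 2 ≤ β * (N * r) ^ 2 := by
      have : β * (N * r) ^ 2 = N * (β * r ^ 2 * N) := by ring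
      rw [this, hr]; nlinarith
    exact le_of_mul_le_mul_left this hβ
  have h2 : (N : ℝ) * (1 / (N : ℝ) ^ 4) ≤ 1 / N := by
    rw [mul_one_div, div_le_div_iff₀ (by positivity) (by positivity), one_mul, ← sq]
    exact pow_le_pow_right₀ hN1 (by norm_num)
  calc _ = ((N : ℝ) * (1 / (N : ℝ) ^ 4)) * (2 * M) := by ring
    _ ≤ (1 / N) * (2 * M) := mul_le_mul_of_nonneg_right h2 (by positivity)
    _ ≤ (1 / N) * (N * r) := mul_le_mul_of_nonneg_left (by linarith) (by positivity)
    _ = r := by field_simp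

end AbstractPart

noncomputable def embG {d : ℕ} (x : GaussParam d) : EuclideanSpace ℝ (Fin d ⊕ Fin d) :=
  WithLp.toLp 2 (Sum.elim x.1 (fun ℓ => Real.sqrt (x.2 ℓ)))

lemma dBW_eq {d : ℕ} (x y : GaussParam d) : dBW x y = ‖embG x - embG y‖ := by
  rw [EuclideanSpace.norm_eq, dBW]
  simp [embG, Fintype.sum_sum_type]

lemma embG_norm {d : ℕ} (x : GaussParam d) (hx : ∀ ℓ, 0 ≤ x.2 ℓ) :
    ‖embG x‖ = Real.sqrt ((∑ ℓ, (x.1 ℓ) ^ 2) + ∑ ℓ, x.2 ℓ) := by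
  rw [EuclideanSpace.norm_eq]
  simp [embG, Fintype.sum_sum_type, Real.sq_sqrt, hx]

lemma gibbsW_eq {d N : ℕ} (β : ℝ) (X : Fin N → GaussParam d) (ξ : GaussParam d) (k : Fin N) :
    gibbsW β X ξ k = absW β (fun k => embG (X k)) (embG ξ) k := by
  simp only [gibbsW, absW, dBW_eq]

lemma embG_Phi {d N : ℕ} (β : ℝ) (X : Fin N → GaussParam d) (ξ : GaussParam d) :
    embG (PhiOp β X ξ) = absT β (fun k => embG (X k)) (embG ξ) := by
  ext ℓ
  unfold absT
  simp only [PhiOp, gibbsW_eq]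
  rcases ℓ with ℓ | ℓ
  · simp [embG]
  · have : 0 ≤ ∑ k, absW β (fun k => embG (X k)) (embG ξ) k * Real.sqrt ((X k).2 ℓ) :=
      Finset.sum_nonneg fun k _ => mul_nonneg (absW_nonneg _ _ _ _) (Real.sqrt_nonneg _)
    have h2 := Real.sqrt_sq this
    simpa [embG] using h2

lemma sep_bound {d : ℕ} (x y : GaussParam d) (β lamMin lamMax L : ℝ) (hβ : 0 < β)
    (hlam : 0 < lamMin)
    (hx : ∀ ℓ, x.2 ℓ ∈ Set.Icc lamMin lamMax) (hy : ∀ ℓ, y.2 ℓ ∈ Set.Icc lamMin lamMax)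
    (hlam' : lamMin ≤ lamMax)
    (h : Ifun x y ≥ (d / 2 : ℝ) * Real.log (4 * Real.pi * lamMax) + (1 / (β * lamMin)) * L) :
    4 * L ≤ β * ‖embG y - embG x‖ ^ 2 := by
  have hmax : 0 < lamMax := hlam.trans_le hlam'
  have h1 : ∑ ℓ, Real.log (x.2 ℓ + y.2 ℓ) ≤ d * Real.log (2 * lamMax) := by
    have : ∀ ℓ ∈ (Finset.univ : Finset (Fin d)),
        Real.log (x.2 ℓ + y.2 ℓ) ≤ Real.log (2 * lamMax) := by
      intro ℓ _
      have := hx ℓ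
      have := hy ℓ
      simp only [Set.mem_Icc] at *
      apply Real.log_le_log <;> linarith
    refine (Finset.sum_le_sum this).trans ?_
    simp
  have h2 : ∑ ℓ, (x.1 ℓ - y.1 ℓ) ^ 2 / (x.2 ℓ + y.2 ℓ) ≤
      (∑ ℓ, (x.1 ℓ - y.1 ℓ) ^ 2) / (2 * lamMin) := by
    rw [Finset.sum_div]
    apply Finset.sum_le_sum
    intro ℓ _
    have := hx ℓ
    have := hy ℓ
    simp only [Set.mem_Icc] at *
    apply div_le_div_of_nonneg_left (sq_nonneg _) <;> linarith
  have h3 : ∑ ℓ, (x.1 ℓ - y.1 ℓ) ^ 2 ≤ ‖embG y - embG x‖ ^ 2 := by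
    rw [norm_sub_rev, ← dBW_eq, dBW, Real.sq_sqrt (by positivity)]
    have : 0 ≤ ∑ ℓ, (Real.sqrt (x.2 ℓ) - Real.sqrt (y.2 ℓ)) ^ 2 := by positivity
    linarith
  have h4 : Real.log (4 * Real.pi * lamMax) = Real.log (2 * Real.pi) + Real.log (2 * lamMax) := by
    rw [← Real.log_mul (by positivity) (by positivity)]
    congr 1; ring
  rw [h4] at h
  unfold Ifun at h
  have h5 : (1 / (β * lamMin)) * L ≤ (1 / 2) * ((∑ ℓ, (x.1 ℓ - y.1 ℓ) ^ 2) / (2 * lamMin)) := by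
    linarith
  have h6 : 4 * L ≤ β * ∑ ℓ, (x.1 ℓ - y.1 ℓ) ^ 2 := by
    have := mul_le_mul_of_nonneg_left h5 (show 0 ≤ 4 * β * lamMin by positivity)
    field_simp at this
    linarith
  exact h6.trans (mul_le_mul_of_nonneg_left h3 hβ.le)

/-- Under the separation condition, the beta constraint and the
size condition on `N`, iterates of `Φ` started in `B_i` converge to the unique
fixed point `X_i*` of `Φ` in `B_i`, within `ε` after
`⌈log((ε/2)√(βN)) / log(144 β M_W² / N)⌉` steps. -/
theorem phi_iterates_converge
    {d N : ℕ} (hN : 0 < N) (β lamMin lamMax MW : ℝ)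
    (hβpos : 0 < β) (hlam : 0 < lamMin) (hlam' : lamMin ≤ lamMax)
    (X : Fin N → GaussParam d)
    (hX : ∀ i ℓ, (X i).2 ℓ ∈ Set.Icc lamMin lamMax)
    (hMW : MW = ⨆ k, Real.sqrt ((∑ ℓ, ((X k).1 ℓ) ^ 2) + ∑ ℓ, (X k).2 ℓ))
    (i : Fin N)
    (hsep : ∀ j, j ≠ i → Ifun (X i) (X j) ≥
      (d / 2 : ℝ) * Real.log (4 * Real.pi * lamMax) +
        (1 / (β * lamMin)) *
          Real.log ((N : ℝ) ^ 3 * β * (4 * MW ^ 2 + 2 * d * (lamMax + lamMin))))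
    (hβc : β > Real.exp 2 / ((4 * MW ^ 2 + 2 * d * (lamMax + lamMin)) * (N : ℝ) ^ 3))
    (hNbig : (N : ℝ) > max (144 * β * MW ^ 2)
      (1 / ((4 * MW ^ 2 + 2 * d * (lamMax + lamMin)) * β)))
    (Xstar : GaussParam d)
    (hXstarball : dBW (X i) Xstar ≤ 1 / Real.sqrt (β * N))
    (hXstareig : ∀ ℓ, Xstar.2 ℓ ∈ Set.Icc lamMin lamMax)
    (hXstarfix : PhiOp β X Xstar = Xstar)
    (hXstaruniq : ∀ ζ : GaussParam d,
      (dBW (X i) ζ ≤ 1 / Real.sqrt (β * N) ∧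
        (∀ ℓ, ζ.2 ℓ ∈ Set.Icc lamMin lamMax)) → PhiOp β X ζ = ζ → ζ = Xstar)
    (ξ : GaussParam d)
    (hξeig : ∀ ℓ, ξ.2 ℓ ∈ Set.Icc lamMin lamMax)
    (hξball : dBW (X i) ξ ≤ 1 / Real.sqrt (β * N))
    (ε : ℝ) (hε : 0 < ε) (hεr : ε < 1 / Real.sqrt (β * N)) :
    ∀ n : ℕ, (n : ℤ) ≥
        ⌈Real.log (ε / 2 * Real.sqrt (β * N)) /
          Real.log (144 * β * MW ^ 2 / N)⌉ →
      dBW ((PhiOp β X)^[n] ξ) Xstar < ε := by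
  intro n hn
  have hNR : (0 : ℝ) < N := by exact_mod_cast hN
  rcases Nat.eq_zero_or_pos d with hd | hd
  · subst hd
    simpa [dBW] using hε
  set Z : Fin N → EuclideanSpace ℝ (Fin d ⊕ Fin d) := fun k => embG (X k) with hZ
  have hM : ∀ k, ‖Z k‖ ≤ MW := by
    intro k
    rw [hZ, hMW]
    show ‖embG (X k)‖ ≤ _
    rw [embG_norm (X k) (fun ℓ => hlam.le.trans (hX k ℓ).1)]
    exact le_ciSup (f := fun k => Real.sqrt ((∑ ℓ, ((X k).1 ℓ) ^ 2) + ∑ ℓ, (X k).2 ℓ))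
      (Set.finite_range _).bddAbove k
  have hMpos : 0 < MW := by
    refine lt_of_lt_of_le ?_ (hM i)
    show 0 < ‖embG (X i)‖
    rw [embG_norm (X i) (fun ℓ => hlam.le.trans (hX i ℓ).1)]
    apply Real.sqrt_pos.mpr
    apply add_pos_of_nonneg_of_pos (by positivity)
    exact Finset.sum_pos (fun ℓ _ => hlam.trans_le (hX i ℓ).1) ⟨⟨0, hd⟩, Finset.mem_univ _⟩
  have hmax : 0 < lamMax := hlam.trans_le hlam'
  set C := 4 * MW ^ 2 + 2 * d * (lamMax + lamMin) with hC
  have hCpos : 0 < C := by positivity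
  have hbig : 144 * β * MW ^ 2 < N := (le_max_left _ _).trans_lt hNbig
  have hNC : 1 < N * (C * β) := by
    have := (le_max_right _ _).trans_lt hNbig
    rwa [div_lt_iff₀ (by positivity)] at this
  have hKe : Real.exp 2 ≤ (N : ℝ) ^ 3 * β * C := by
    rw [gt_iff_lt, div_lt_iff₀ (by positivity)] at hβc
    linarith
  have hKpos : 0 < (N : ℝ) ^ 3 * β * C := by positivity
  have hKN : (N : ℝ) ^ 2 ≤ (N : ℝ) ^ 3 * β * C := by
    nlinarith [mul_le_mul_of_nonneg_left hNC.le (sq_nonneg (N : ℝ))]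
  set L := Real.log ((N : ℝ) ^ 3 * β * C) with hLdef
  have hL2 : 2 ≤ L := (Real.le_log_iff_exp_le hKpos).mpr hKe
  have hLN : (N : ℝ) ^ 2 ≤ Real.exp L := by rwa [hLdef, Real.exp_log hKpos]
  have hsq : 0 < Real.sqrt (β * N) := Real.sqrt_pos.mpr (by positivity)
  set r := 1 / Real.sqrt (β * N) with hrdef
  have hrpos : 0 < r := by positivity
  have hr : β * r ^ 2 * N = 1 := by
    rw [hrdef, div_pow, Real.sq_sqrt (by positivity)]
    field_simp
  have hw : ∀ z, ‖Z i - z‖ ≤ r → ∀ j, j ≠ i → absW β Z z j ≤ 1 / (N : ℝ) ^ 4 := by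
    intro z hz j hj
    exact absW_small β L r hβpos Z i j hj hL2 hLN hrpos.le hr
      (sep_bound (X i) (X j) β lamMin lamMax L hβpos hlam (hX i) (hX j) hlam' (hsep j hj)) z hz
  have hstar : ‖Z i - embG Xstar‖ ≤ r := by rw [← dBW_eq]; exact hXstarball
  have hfix : absT β Z (embG Xstar) = embG Xstar := by
    rw [← embG_Phi, hXstarfix]
  set q := 144 * β * MW ^ 2 / N with hq
  have hqpos : 0 < q := by positivity
  have hq1 : q < 1 := by rw [hq, div_lt_one hNR]; exact hbig
  have hq8 : 8 * β * MW ^ 2 / N = q / 18 := by rw [hq]; ring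
  have hiter : ∀ m : ℕ, ‖Z i - embG ((PhiOp β X)^[m] ξ)‖ ≤ r ∧
      ‖embG ((PhiOp β X)^[m] ξ) - embG Xstar‖ ≤ (q / 18) ^ m * (2 * r) := by
    intro m
    induction m with
    | zero =>
      have h0 : ‖Z i - embG ξ‖ ≤ r := by rw [← dBW_eq]; exact hξball
      refine ⟨h0, ?_⟩
      have := norm_sub_le (Z i - embG Xstar) (Z i - embG ξ)
      rw [sub_sub_sub_cancel_left] at this
      simp only [Function.iterate_zero, id, pow_zero]
      linarith
    | succ m ih =>
      rw [Function.iterate_succ_apply', embG_Phi]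
      refine ⟨absT_ball hN β MW r hβpos Z i hM hrpos.le hr hbig _ (hw _ ih.1), ?_⟩
      have := absT_diff hN β MW hβpos Z i hM _ _ (hw _ ih.1) (hw _ hstar)
      rw [hfix, hq8] at this
      refine this.trans ?_
      calc _ ≤ q / 18 * ((q / 18) ^ m * (2 * r)) :=
            mul_le_mul_of_nonneg_left ih.2 (by positivity)
        _ = _ := by ring
  rw [dBW_eq]
  refine (hiter n).2.trans_lt ?_
  have hn' : Real.log (ε / 2 * Real.sqrt (β * N)) / Real.log q ≤ n := by
    have := Int.ceil_le.mp hn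
    exact_mod_cast this
  have hlq : Real.log q < 0 := Real.log_neg hqpos hq1
  have harg : ε / 2 * Real.sqrt (β * N) = ε / (2 * r) := by
    rw [hrdef]; field_simp
  rw [harg] at hn'
  have hargpos : 0 < ε / (2 * r) := by positivity
  have hargneg : Real.log (ε / (2 * r)) < 0 := by
    apply Real.log_neg hargpos
    rw [div_lt_one (by positivity)]
    linarith
  have hn0 : n ≠ 0 := by
    intro h
    rw [h] at hn'
    have := div_pos_of_neg_of_neg hargneg hlq
    simp only [Nat.cast_zero] at hn'
    linarith
  have hqn : q ^ n ≤ ε / (2 * r) := by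
    rw [div_le_iff_of_neg hlq] at hn'
    rw [← Real.log_le_log_iff (by positivity) hargpos, Real.log_pow]
    exact hn'
  have hlt : (q / 18) ^ n < q ^ n := pow_lt_pow_left₀ (by linarith) (by positivity) hn0
  calc _ < ε / (2 * r) * (2 * r) := mul_lt_mul_of_pos_right (hlt.trans_le hqn) (by positivity)
    _ = ε := by field_simp
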